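/- arXiv:2106.14665 — 15 statements merged into one kernel-verified Lean document; each statement's English description precedes it below -/
import Mathlib

section
/- Let A, B, C, D, t, u be integers such that t and u are relatively prime, B·t² + C·t·u + D·u² ≠ 0, and A divides B·t² + C·t·u + D·u². Then there exist integers L, M, N, s, x such that s and x are relatively prime, A = L·s² + M·s·x + N·x², and 4·L·N − M² = 4·B·D − C². -/
theorem stmt_0 (A B C D t u : ℤ) (hcop : IsCoprime t u)
    (hne : B * t ^ 2 + C * t * u + D * u ^ 2 ≠ 0)
    (hdvd : A ∣ B * t ^ 2 + C * t * u + D * u ^ 2) :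
    ∃ L M N s x : ℤ, IsCoprime s x ∧
      A = L * s ^ 2 + M * s * x + N * x ^ 2 ∧
      4 * L * N - M ^ 2 = 4 * B * D - C ^ 2 := by
  obtain ⟨a, b, hab⟩ := hcop
  obtain ⟨k, hk⟩ := hdvd
  refine ⟨A, -2 * B * t * b + C * (t * a - u * b) + 2 * D * u * a,
    k * (B * b ^ 2 - C * b * a + D * a ^ 2), 1, 0, isCoprime_one_left, by ring, ?_⟩
  linear_combination (-4 * (B * b ^ 2 - C * b * a + D * a ^ 2)) * hk
    + (4 * B * D - C ^ 2) * (a * t + b * u + 1) * hab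
end

section
/- Let A, B, C, D, t, u be integers such that t and u are relatively prime, B·t² + C·t·u + D·u² ≠ 0, A divides B·t² + C·t·u + D·u², and 4·B·D − C² > 0. Then there exist integers P, Q, R, y, z such that y and z are relatively prime, A = P·y² + Q·y·z + R·z², 4·P·R − Q² = 4·B·D − C², |Q| ≤ |P|, |Q| ≤ |R|, and moreover 3·Q² ≤ 4·B·D − C². -/
theorem reduce_aux (A Δ : ℤ) (hΔ : 0 < Δ) : ∀ (n : ℕ) (P Q R y z : ℤ), Q.natAbs ≤ n →
    IsCoprime y z → A = P * y ^ 2 + Q * y * z + R * z ^ 2 → 4 * P * R - Q ^ 2 = Δ →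
    ∃ P Q R y z : ℤ, IsCoprime y z ∧ A = P * y ^ 2 + Q * y * z + R * z ^ 2 ∧
      4 * P * R - Q ^ 2 = Δ ∧ |Q| ≤ |P| ∧ |Q| ≤ |R| := by
  intro n
  induction n with
  | zero =>
    intro P Q R y z hQ hc hA hD
    have : Q = 0 := by omega
    subst this
    exact ⟨P, 0, R, y, z, hc, hA, hD, by simp, by simp⟩
  | succ n ih =>
    have key : ∀ P Q R y z : ℤ, Q.natAbs ≤ n + 1 → IsCoprime y z →
        A = P * y ^ 2 + Q * y * z + R * z ^ 2 → 4 * P * R - Q ^ 2 = Δ → |P| < |Q| →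
        ∃ P Q R y z : ℤ, IsCoprime y z ∧ A = P * y ^ 2 + Q * y * z + R * z ^ 2 ∧
          4 * P * R - Q ^ 2 = Δ ∧ |Q| ≤ |P| ∧ |Q| ≤ |R| := by
      intro P Q R y z hQ hc hA hD hlt
      have hP : P ≠ 0 := by
        rintro rfl
        nlinarith [sq_nonneg Q]
      rw [Int.abs_eq_natAbs, Int.abs_eq_natAbs] at hlt
      have hs : ∃ s : ℤ, (Q - 2 * P * s).natAbs ≤ n := by
        by_cases h : (Q - 2 * P).natAbs ≤ n
        · exact ⟨1, by simpa using h⟩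
        · refine ⟨-1, ?_⟩
          have e : Q - 2 * P * (-1) = Q + 2 * P := by ring
          rw [e]
          omega
      obtain ⟨s, hs⟩ := hs
      refine ih P (Q - 2 * P * s) (P * s ^ 2 - Q * s + R) (y + s * z) z hs ?_ ?_ ?_
      · exact (IsCoprime.add_mul_right_left_iff).2 hc
      · rw [hA]; ring
      · rw [← hD]; ring
    intro P Q R y z hQ hc hA hD
    by_cases h1 : |P| < |Q|
    · exact key P Q R y z hQ hc hA hD h1
    by_cases h2 : |R| < |Q|
    · exact key R Q P z y hQ hc.symm (by rw [hA]; ring) (by rw [← hD]; ring) h2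
    exact ⟨P, Q, R, y, z, hc, hA, hD, not_lt.1 h1, not_lt.1 h2⟩


theorem stmt_2 (A B C D t u : ℤ) (hcop : IsCoprime t u)
    (hne : B * t ^ 2 + C * t * u + D * u ^ 2 ≠ 0)
    (hdvd : A ∣ B * t ^ 2 + C * t * u + D * u ^ 2)
    (hpos : 4 * B * D - C ^ 2 > 0) :
    ∃ P Q R y z : ℤ, IsCoprime y z ∧
      A = P * y ^ 2 + Q * y * z + R * z ^ 2 ∧
      4 * P * R - Q ^ 2 = 4 * B * D - C ^ 2 ∧
      |Q| ≤ |P| ∧ |Q| ≤ |R| ∧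
      3 * Q ^ 2 ≤ 4 * B * D - C ^ 2 := by

  obtain ⟨a, b, hab⟩ := hcop
  obtain ⟨k, hk⟩ := hdvd
  have hdisc : 4 * A * (k * (B * b ^ 2 - C * a * b + D * a ^ 2)) -
      (-2 * B * t * b + C * (a * t - b * u) + 2 * D * u * a) ^ 2 = 4 * B * D - C ^ 2 := by
    have e1 : 4 * A * (k * (B * b ^ 2 - C * a * b + D * a ^ 2)) =
        4 * (B * t ^ 2 + C * t * u + D * u ^ 2) * (B * b ^ 2 - C * a * b + D * a ^ 2) := by
      rw [hk]; ring
    have e2 : (4 * B * D - C ^ 2) = (4 * B * D - C ^ 2) * (a * t + b * u) ^ 2 := by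
      rw [hab]; ring
    rw [e1, e2]; ring
  obtain ⟨P, Q, R, y, z, hc, hA, hD, h1, h2⟩ :=
    reduce_aux A (4 * B * D - C ^ 2) hpos _ A _ _ 1 0 le_rfl isCoprime_one_left (by ring) hdisc
  refine ⟨P, Q, R, y, z, hc, hA, hD, h1, h2, ?_⟩
  have hPR : 0 < P * R := by nlinarith [sq_nonneg Q]
  have h3 : |Q| * |Q| ≤ |P| * |R| := mul_le_mul h1 h2 (abs_nonneg _) (abs_nonneg _)
  rw [← abs_mul P R, abs_of_pos hPR, abs_mul_abs_self] at h3
  nlinarith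
end

section
/- Let a, t, u, A be integers with a ≥ 1, t and u relatively prime, A > 0, and A divides t² + a·u². Then there exist integers p, x, z with 1 ≤ p and 3·p² ≤ 4·a such that p·A = x² + a·z². -/
theorem form_min_aux (a : ℤ) (ha : 1 ≤ a) : ∀ (n : ℕ) (A k C : ℤ), A.toNat ≤ n → 0 < A →
    A * C - k ^ 2 = a →
    ∃ y z p : ℤ, p = A * y ^ 2 + 2 * k * y * z + C * z ^ 2 ∧ 1 ≤ p ∧ 3 * p ^ 2 ≤ 4 * a := by
  intro n
  induction n with
  | zero => intro A k C h1 h2; omega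
  | succ n ih =>
    intro A k C hn hA h
    by_cases hs : 3 * A ^ 2 ≤ 4 * a
    · exact ⟨1, 0, A, by ring, hA, hs⟩
    · obtain ⟨m, hm1, hm2⟩ : ∃ m : ℤ, 2 * (k + m * A) ≤ A ∧ -A ≤ 2 * (k + m * A) := by
        refine ⟨-((2 * k + A) / (2 * A)), ?_, ?_⟩
        · have := Int.lt_ediv_add_one_mul_self (2 * k + A) (show 0 < 2 * A by omega)
          nlinarith
        · have := Int.ediv_mul_le (2 * k + A) (show 2 * A ≠ 0 by omega)
          nlinarith
      have hdet : A * (C + 2 * k * m + A * m ^ 2) - (k + m * A) ^ 2 = a := by rw [← h]; ring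
      generalize hC : C + 2 * k * m + A * m ^ 2 = C' at hdet
      generalize hk : k + m * A = k' at hdet hm1 hm2
      have hCpos : 0 < C' := by
        by_contra hc
        nlinarith [sq_nonneg k']
      have hlt : C' < A := by
        by_contra hc
        nlinarith [sq_nonneg k']
      obtain ⟨y, z, p, hp, h1, h2⟩ := ih C' k' A (by omega) hCpos (by linarith)
      refine ⟨z + m * y, y, p, ?_, h1, h2⟩
      rw [hp, ← hC, ← hk]; ring


theorem stmt_4 (a t u A : ℤ) (ha : a ≥ 1) (hcop : IsCoprime t u)
    (hA : A > 0) (hdvd : A ∣ t ^ 2 + a * u ^ 2) :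
    ∃ p x z : ℤ, 1 ≤ p ∧ 3 * p ^ 2 ≤ 4 * a ∧
      p * A = x ^ 2 + a * z ^ 2 := by
  have hAu : IsCoprime u A := by
    have h1 : IsCoprime u (t ^ 2 + a * u ^ 2) := by
      have : IsCoprime u (t ^ 2) := hcop.symm.pow_right
      have := this.add_mul_left_right (a * u)
      rwa [show u * (a * u) = a * u ^ 2 by ring] at this
    exact h1.of_isCoprime_of_dvd_right hdvd
  obtain ⟨v, w, hvw⟩ := hAu
  obtain ⟨q, hq⟩ := hdvd
  have hd : A ∣ (t * v) ^ 2 + a := by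
    refine ⟨q * v ^ 2 + a * w * (1 + v * u), ?_⟩
    have e : w * A = 1 - v * u := by linarith
    linear_combination v ^ 2 * hq - a * (1 + v * u) * e
  obtain ⟨C, hC⟩ := hd
  obtain ⟨y, z, p, hp, h1, h2⟩ :=
    form_min_aux a ha A.toNat A (t * v) C le_rfl hA (by linarith)
  refine ⟨p, A * y + t * v * z, z, h1, h2, ?_⟩
  rw [hp]
  linear_combination (-z ^ 2) * hC
end

section
/- Let t, u, d be integers with t and u relatively prime, d > 0, and d dividing t² + u². Then there exist integers y and z such that d = y² + z². (Every positive divisor of a sum of two relatively prime squares is itself a sum of two squares.) -/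
theorem stmt_5 (t u d : ℤ) (hcop : IsCoprime t u) (hd : d > 0)
    (hdvd : d ∣ t ^ 2 + u ^ 2) :
    ∃ y z : ℤ, d = y ^ 2 + z ^ 2 := by
  have h := ZMod.isSquare_neg_one_of_dvd (Int.natAbs_dvd_natAbs.mpr hdvd)
    (ZMod.isSquare_neg_one_of_eq_sq_add_sq_of_isCoprime rfl hcop)
  obtain ⟨x, y, hxy⟩ := Nat.eq_sq_add_sq_of_isSquare_mod_neg_one h
  refine ⟨x, y, ?_⟩
  have h2 : ((d.natAbs : ℕ) : ℤ) = d := Int.natAbs_of_nonneg hd.le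
  rw [← h2, hxy]
  push_cast
  rfl
end

section
/- Let t, u, d be integers with t and u relatively prime, d > 0, and d dividing t² + 2·u². Then there exist integers y and z such that d = y² + 2·z². -/
/-- Reduction theory: a positive form of determinant 2 is equivalent to `A² + 2B²`. -/
theorem form_aux (n : ℕ) : ∀ d x c : ℤ, 0 < d → d ≤ n → d * c = x ^ 2 + 2 →
    ∃ p q r s : ℤ, d = p ^ 2 + 2 * q ^ 2 ∧ x = p * r + 2 * q * s ∧ c = r ^ 2 + 2 * s ^ 2 := by
  induction n with
  | zero => intro d x c h1 h2; push_cast at h2; omega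
  | succ n ih =>
    intro d x c hd hn h
    push_cast at hn
    by_cases h1 : d = 1
    · subst h1
      exact ⟨1, 0, x, 1, by ring, by ring, by linarith⟩
    have hd2 : 2 ≤ d := by omega
    obtain ⟨k, y, hxy, hy1, hy2⟩ : ∃ k y : ℤ, x = y + k * d ∧ -d ≤ 2 * y ∧ 2 * y ≤ d := by
      have e := Int.mul_ediv_add_emod (2 * x + d) (2 * d)
      have e1 := Int.emod_nonneg (2 * x + d) (show 2 * d ≠ 0 by omega)
      have e2 := Int.emod_lt_of_pos (2 * x + d) (show 0 < 2 * d by omega)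
      refine ⟨(2 * x + d) / (2 * d), x - (2 * x + d) / (2 * d) * d, by ring, ?_, ?_⟩ <;> nlinarith
    subst hxy
    obtain ⟨c', hc'⟩ : ∃ c', c' = c - 2 * k * y - k ^ 2 * d := ⟨_, rfl⟩
    have h' : c' * d = y ^ 2 + 2 := by rw [hc']; linarith
    have hpos : 0 < c' := by
      by_contra hh
      nlinarith [sq_nonneg y]
    have hlt : c' < d := by
      by_contra hh
      nlinarith [mul_nonneg (sub_nonneg.2 hy1) (sub_nonneg.2 hy2)]
    obtain ⟨r, s, p, q, e1, e2, e3⟩ := ih c' y d hpos (by omega) h'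
    refine ⟨p, q, r + k * p, s + k * q, e3, ?_, ?_⟩
    · rw [e2, e3]; ring
    · have : c = c' + 2 * k * y + k ^ 2 * d := by rw [hc']; ring
      rw [this, e1, e2, e3]; ring

theorem stmt_6 (t u d : ℤ) (hcop : IsCoprime t u) (hd : d > 0)
    (hdvd : d ∣ t ^ 2 + 2 * u ^ 2) :
    ∃ y z : ℤ, d = y ^ 2 + 2 * z ^ 2 := by
  have h1 : IsCoprime (t ^ 2 + u * (2 * u)) u := (hcop.pow_left (m := 2)).add_mul_left_left _
  have h2 : IsCoprime d u :=
    h1.of_isCoprime_of_dvd_left (by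
      rwa [show t ^ 2 + u * (2 * u) = t ^ 2 + 2 * u ^ 2 by ring])
  obtain ⟨a, b, hab⟩ := h2
  obtain ⟨m, hm⟩ := hdvd
  obtain ⟨p, q, r, s, e, -, -⟩ := form_aux d.toNat d (t * b)
    (b ^ 2 * m + 2 * a * (1 + b * u)) hd (by omega) (by
      have hu : d * a = 1 - b * u := by linarith
      linear_combination (-b ^ 2) * hm + 2 * (1 + b * u) * hu)
  exact ⟨p, q, e⟩
end

section
/- Let t, u, d be integers with t and u relatively prime, d > 0, d odd, and d dividing t² + 3·u². Then there exist integers y and z such that d = y² + 3·z². -/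
lemma form_red (n : ℕ) : ∀ a b c : ℤ, a.toNat ≤ n → 0 < a → a * c - b ^ 2 = 3 →
    (¬ 2 ∣ a ∨ ¬ 2 ∣ c) →
    ∃ p q r s : ℤ, a = p ^ 2 + 3 * r ^ 2 ∧ c = q ^ 2 + 3 * s ^ 2 ∧ b = p * q + 3 * r * s := by
  induction n with
  | zero => intro a b c h h0; omega
  | succ n ih =>
    intro a b c hn ha hdet hodd
    obtain ⟨k, b', hb, h1, h2⟩ : ∃ k b' : ℤ, b = b' + k * a ∧ -a ≤ 2 * b' ∧ 2 * b' ≤ a := by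
      have e := Int.emod_add_mul_ediv b a
      have l1 := Int.emod_nonneg b ha.ne'
      have l2 := Int.emod_lt_of_pos b ha
      by_cases h : 2 * (b % a) ≤ a
      · exact ⟨b / a, b % a, by linarith, by linarith, h⟩
      · exact ⟨b / a + 1, b % a - a, by linarith, by linarith, by linarith⟩
    obtain ⟨c', hc⟩ : ∃ c' : ℤ, c = c' + 2 * k * b' + k ^ 2 * a := ⟨c - 2 * k * b' - k ^ 2 * a, by ring⟩
    have hdet' : a * c' - b' ^ 2 = 3 := by rw [← hdet, hb, hc]; ring
    have hodd' : ¬ 2 ∣ a ∨ ¬ 2 ∣ c' := by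
      by_contra! hh
      obtain ⟨⟨x, hx⟩, ⟨y, hy⟩⟩ := hh
      rcases hodd with h | h
      · exact h ⟨x, hx⟩
      · exact h ⟨y + k * b' + k ^ 2 * x, by rw [hc, hx, hy]; ring⟩
    suffices H : ∃ p q r s : ℤ, a = p ^ 2 + 3 * r ^ 2 ∧ c' = q ^ 2 + 3 * s ^ 2 ∧
        b' = p * q + 3 * r * s by
      obtain ⟨p, q, r, s, e1, e2, e3⟩ := H
      refine ⟨p, q + k * p, r, s + k * r, e1, ?_, ?_⟩
      · rw [hc, e1, e2, e3]; ring
      · rw [hb, e1, e3]; ring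
    have hc0 : 0 < c' := by nlinarith [sq_nonneg b']
    by_cases hlt : c' < a
    · obtain ⟨p, q, r, s, e1, e2, e3⟩ := ih c' b' a (by omega) hc0 (by linarith) hodd'.symm
      exact ⟨q, p, s, r, e2, e1, by rw [e3]; ring⟩
    · have ha2 : a ≤ 2 := by nlinarith
      have hb1 : -1 ≤ b' := by omega
      have hb2 : b' ≤ 1 := by omega
      interval_cases a
      · obtain rfl : b' = 0 := by omega
        exact ⟨1, 0, 0, 1, by norm_num, by linarith, by norm_num⟩
      · exfalso
        interval_cases b' <;> omega

theorem stmt_7 (t u d : ℤ) (hcop : IsCoprime t u) (hd : d > 0)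
    (hodd : ¬ (2 ∣ d)) (hdvd : d ∣ t ^ 2 + 3 * u ^ 2) :
    ∃ y z : ℤ, d = y ^ 2 + 3 * z ^ 2 := by
  obtain ⟨m, hm⟩ := hdvd
  have h1 : IsCoprime (d * m) u := by
    rw [← hm]
    have : IsCoprime (t ^ 2 + u * (3 * u)) u := IsCoprime.add_mul_left_left hcop.pow_left _
    convert this using 1; ring
  obtain ⟨x, y, hxy⟩ := h1.of_mul_left_left
  -- y * u = 1 - x * d
  have hy : y * u = 1 - x * d := by linarith
  have hdet : d * (m * y ^ 2 + 6 * x - 3 * x ^ 2 * d) - (t * y) ^ 2 = 3 := by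
    have : d * m * y ^ 2 = (t * y) ^ 2 + 3 * (y * u) ^ 2 := by rw [← hm]; ring
    rw [hy] at this
    linarith
  obtain ⟨p, q, r, s, e, -⟩ := form_red d.toNat d (t * y) _ le_rfl hd hdet (Or.inl hodd)
  exact ⟨p, r, e⟩
end

section
/- Let t, u, d be integers with t and u relatively prime, d > 0, d odd, and d dividing t² + 4·u². Then there exist integers y and z such that d = y² + 4·z². -/
theorem aux_sum (a b d : ℤ) (hcop : IsCoprime a b) (hd : d > 0)
    (hodd : ¬ (2 ∣ d)) (hdvd : d ∣ a ^ 2 + b ^ 2) :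
    ∃ y z : ℤ, d = y ^ 2 + 4 * z ^ 2 := by
  have h1 := ZMod.isSquare_neg_one_of_eq_sq_add_sq_of_isCoprime rfl hcop
  have h2 := ZMod.isSquare_neg_one_of_dvd (Int.natAbs_dvd_natAbs.mpr hdvd) h1
  obtain ⟨x, y, h⟩ := Nat.eq_sq_add_sq_of_isSquare_mod_neg_one h2
  have h3 : d = (x : ℤ) ^ 2 + (y : ℤ) ^ 2 := by
    have : (d.natAbs : ℤ) = d := Int.natAbs_of_nonneg hd.le
    rw [← this, h]; push_cast; ring
  generalize (x : ℤ) = x at h3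
  generalize (y : ℤ) = y at h3
  rcases Int.even_or_odd' x with ⟨k, rfl | rfl⟩
  · exact ⟨y, k, by rw [h3]; ring⟩
  · rcases Int.even_or_odd' y with ⟨l, rfl | rfl⟩
    · exact ⟨2 * k + 1, l, by rw [h3]; ring⟩
    · exact absurd ⟨2 * k ^ 2 + 2 * k + 2 * l ^ 2 + 2 * l + 1, by rw [h3]; ring⟩ hodd

theorem stmt_8 (t u d : ℤ) (hcop : IsCoprime t u) (hd : d > 0)
    (hodd : ¬ (2 ∣ d)) (hdvd : d ∣ t ^ 2 + 4 * u ^ 2) :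
    ∃ y z : ℤ, d = y ^ 2 + 4 * z ^ 2 := by
  rcases Int.even_or_odd' t with ⟨k, rfl | rfl⟩
  · refine aux_sum k u d (IsCoprime.of_mul_left_right hcop) hd hodd ?_
    have h2 : IsCoprime d 2 :=
      ((Prime.coprime_iff_not_dvd Int.prime_two).mpr hodd).symm
    have h4 : IsCoprime d (2 * 2) := h2.mul_right h2
    refine h4.dvd_of_dvd_mul_left ?_
    rwa [show 2 * 2 * (k ^ 2 + u ^ 2) = (2 * k) ^ 2 + 4 * u ^ 2 by ring]
  · refine aux_sum (2 * k + 1) (2 * u) d (IsCoprime.mul_right ⟨1, -k, by ring⟩ hcop) hd hodd ?_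
    rwa [show (2 * k + 1) ^ 2 + (2 * u) ^ 2 = (2 * k + 1) ^ 2 + 4 * u ^ 2 by ring]
end

section
/- Let t, u, d be integers with t and u relatively prime, d > 0, and d dividing t² + 5·u². Then there exist integers y and z such that either d = y² + 5·z² or d = 2·y² + 2·y·z + 3·z². -/
def Rep9 (a b c : ℤ) : Prop := ∃ p q r w : ℤ,
  (a = p^2+5*r^2 ∧ b = p*q+5*r*w ∧ c = q^2+5*w^2) ∨
  (a = 2*p^2+2*p*r+3*r^2 ∧ b = 2*p*q+p*w+q*r+3*r*w ∧ c = 2*q^2+2*q*w+3*w^2)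

lemma Rep9.swap {a b c : ℤ} (h : Rep9 c b a) : Rep9 a b c := by
  obtain ⟨p, q, r, w, ⟨h1, h2, h3⟩ | ⟨h1, h2, h3⟩⟩ := h
  · exact ⟨q, p, w, r, Or.inl ⟨h3, by rw [h2]; ring, h1⟩⟩
  · exact ⟨q, p, w, r, Or.inr ⟨h3, by rw [h2]; ring, h1⟩⟩

lemma Rep9.neg {a b c : ℤ} (h : Rep9 a (-b) c) : Rep9 a b c := by
  obtain ⟨p, q, r, w, ⟨h1, h2, h3⟩ | ⟨h1, h2, h3⟩⟩ := h
  · exact ⟨p, -q, r, -w, Or.inl ⟨h1, by linear_combination -h2, by rw [h3]; ring⟩⟩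
  · exact ⟨p, -q, r, -w, Or.inr ⟨h1, by linear_combination -h2, by rw [h3]; ring⟩⟩

lemma Rep9.shift {a b c : ℤ} (h : Rep9 a (b-a) (c-2*b+a)) : Rep9 a b c := by
  obtain ⟨p, q, r, w, ⟨h1, h2, h3⟩ | ⟨h1, h2, h3⟩⟩ := h
  · exact ⟨p, q+p, r, w+r, Or.inl ⟨h1, by linear_combination h2+h1,
      by linear_combination h3+2*h2+h1⟩⟩
  · exact ⟨p, q+p, r, w+r, Or.inr ⟨h1, by linear_combination h2+h1,
      by linear_combination h3+2*h2+h1⟩⟩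

lemma rep9_main (n : ℕ) : ∀ a b c : ℤ, 0 < a → |b| ≤ n → a*c = b^2+5 → Rep9 a b c := by
  induction n with
  | zero =>
    intro a b c ha hb h
    have hb0 : b = 0 := by simpa using hb
    subst hb0
    have hc : 0 < c := by nlinarith
    have : a ≤ 5 := by nlinarith
    interval_cases a
    · exact ⟨1, 0, 0, 1, Or.inl ⟨by norm_num, by norm_num, by omega⟩⟩
    · omega
    · omega
    · omega
    · exact ⟨0, 1, 1, 0, Or.inl ⟨by norm_num, by norm_num, by omega⟩⟩
  | succ n ih =>
    have key : ∀ a b c : ℤ, 0 < a → 0 ≤ b → a ≤ c → b ≤ n+1 → a*c = b^2+5 → Rep9 a b c := by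
      intro a b c ha hb hac hbn h
      by_cases h1 : b ≤ n
      · exact ih a b c ha (by rwa [abs_of_nonneg hb]) h
      by_cases h2 : a < 2*b
      · apply Rep9.shift
        apply ih _ _ _ ha
        · rw [abs_le]; constructor <;> omega
        · linear_combination h
      · have hb1 : b = 1 := by
          have : 1 ≤ b := by omega
          nlinarith
        subst hb1
        have : a ≤ 2 := by nlinarith
        have : a = 2 := by omega
        subst this
        exact ⟨1, 0, 0, 1, Or.inr ⟨by norm_num, by norm_num, by omega⟩⟩
    have key2 : ∀ a b c : ℤ, 0 < a → 0 ≤ b → b ≤ n+1 → a*c = b^2+5 → Rep9 a b c := by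
      intro a b c ha hb hbn h
      have hc : 0 < c := by
        by_contra hc
        nlinarith [sq_nonneg b]
      rcases le_total a c with hh | hh
      · exact key a b c ha hb hh hbn h
      · exact (key c b a hc hb hh hbn (by linarith)).swap
    intro a b c ha hb h
    push_cast at hb
    rw [abs_le] at hb
    rcases le_total 0 b with hh | hh
    · exact key2 a b c ha hh hb.2 h
    · exact (key2 a (-b) c ha (by omega) (by omega) (by linarith)).neg

theorem stmt_9 (t u d : ℤ) (hcop : IsCoprime t u) (hd : d > 0)
    (hdvd : d ∣ t ^ 2 + 5 * u ^ 2) :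
    ∃ y z : ℤ, d = y ^ 2 + 5 * z ^ 2 ∨
      d = 2 * y ^ 2 + 2 * y * z + 3 * z ^ 2 := by
  obtain ⟨k, hk⟩ := hdvd
  have hud : IsCoprime u d := by
    have h1 : IsCoprime u (t^2 + u * (5*u)) := (hcop.symm.pow_right).add_mul_left_right _
    have h2 : t^2 + u*(5*u) = d*k := by linear_combination hk
    rw [h2] at h1
    exact h1.of_mul_right_left
  obtain ⟨a, b, hab⟩ := hud
  have h : d * (k*a^2 + 5*b*(2 - d*b)) = (t*a)^2 + 5 := by
    linear_combination -a^2 * hk + 5*(a*u + 1 - b*d)*hab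
  obtain ⟨p, q, r, w, ⟨h1, -⟩ | ⟨h1, -⟩⟩ := rep9_main (t*a).natAbs d (t*a) _ hd (by simp) h
  · exact ⟨p, r, Or.inl h1⟩
  · exact ⟨p, r, Or.inr h1⟩
end

section
/- Let t, u, d be integers with t and u relatively prime, d > 0, d odd, and d dividing t² + 7·u². Then there exist integers y and z such that d = y² + 7·z². -/
theorem red_aux (n : ℕ) : ∀ a b c : ℤ, 0 < a → a ≤ n → a * c = b ^ 2 + 7 →
    ¬ (2 ∣ a ∧ 2 ∣ c) →
    ∃ p q r s : ℤ, a = p ^ 2 + 7 * r ^ 2 ∧ b = p * q + 7 * r * s ∧ c = q ^ 2 + 7 * s ^ 2 := by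
  induction n with
  | zero => intro a b c h1 h2; push_cast at h2; omega
  | succ n ih =>
    intro a b c ha hn h hpar
    obtain ⟨k, hk1, hk2⟩ : ∃ k : ℤ, -a ≤ 2 * (b - k * a) ∧ 2 * (b - k * a) ≤ a := by
      refine ⟨(2 * b + a) / (2 * a), ?_, ?_⟩
      · have := Int.ediv_mul_le (2 * b + a) (b := 2 * a) (by omega)
        linarith
      · have := Int.lt_ediv_add_one_mul_self (2 * b + a) (b := 2 * a) (by omega)
        linarith
    obtain ⟨b', hb'⟩ : ∃ b', b' = b - k * a := ⟨_, rfl⟩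
    obtain ⟨c', hc'⟩ : ∃ c', c' = c - 2 * k * b + k ^ 2 * a := ⟨_, rfl⟩
    rw [← hb'] at hk1 hk2
    have h' : a * c' = b' ^ 2 + 7 := by subst hb' hc'; linear_combination h
    have hpar' : ¬ (2 ∣ a ∧ 2 ∣ c') := by
      rintro ⟨⟨x, hx⟩, ⟨y, hy⟩⟩
      exact hpar ⟨⟨x, hx⟩, ⟨y + k * b - k ^ 2 * x, by subst hx; linarith⟩⟩
    have hc0 : 0 < c' := by
      by_contra hh
      nlinarith [sq_nonneg b']
    suffices ∃ p q r s : ℤ, a = p ^ 2 + 7 * r ^ 2 ∧ b' = p * q + 7 * r * s ∧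
        c' = q ^ 2 + 7 * s ^ 2 by
      obtain ⟨p, q, r, s, e1, e2, e3⟩ := this
      refine ⟨p, q + k * p, r, s + k * r, e1, ?_, ?_⟩
      · linear_combination e2 - hb' + k * e1
      · linear_combination e3 - hc' + 2 * k * (e2 - hb') + k ^ 2 * e1
    by_cases hlt : c' < a
    · obtain ⟨p, q, r, s, e1, e2, e3⟩ := ih c' b' a hc0 (by push_cast at hn; omega)
        (by linarith) (fun ⟨x, y⟩ => hpar' ⟨y, x⟩)
      exact ⟨q, p, s, r, e3, by linarith, e1⟩
    · push Not at hlt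
      have ha3 : a ≤ 3 := by
        by_contra hh
        push Not at hh
        nlinarith [mul_nonneg (by linarith : 0 ≤ a - 2 * b') (by linarith : 0 ≤ a + 2 * b')]
      have : -1 ≤ b' := by omega
      have : b' ≤ 1 := by omega
      clear hb' hc'
      interval_cases a <;> interval_cases b' <;> try omega
      exact ⟨1, 0, 0, 1, by norm_num, by norm_num, by linarith⟩

theorem stmt_11 (t u d : ℤ) (hcop : IsCoprime t u) (hd : d > 0)
    (hodd : ¬ (2 ∣ d)) (hdvd : d ∣ t ^ 2 + 7 * u ^ 2) :
    ∃ y z : ℤ, d = y ^ 2 + 7 * z ^ 2 := by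
  obtain ⟨m, hm⟩ := hdvd
  have hc : IsCoprime u d := by
    have h1 : IsCoprime u (t ^ 2) := hcop.symm.pow_right
    have h2 : IsCoprime u (t ^ 2 + u * (7 * u)) := h1.add_mul_left_right _
    have h3 : t ^ 2 + u * (7 * u) = d * m := by rw [← hm]; ring
    rw [h3] at h2
    exact h2.of_mul_right_left
  obtain ⟨e, f, hef⟩ := hc
  obtain ⟨p, q, r, s, e1, -, -⟩ := red_aux d.toNat d (t * e)
    (e ^ 2 * m + 14 * e * u * f + 7 * f ^ 2 * d) hd (by omega)
    (by linear_combination -e ^ 2 * hm + 7 * (e * u + f * d + 1) * hef)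
    (fun h => hodd h.1)
  exact ⟨p, r, e1⟩
end

section
/- Let t, u, d be integers with t and u relatively prime, d > 0, d odd, and d dividing t² + 8·u². Then there exist integers y and z such that either d = y² + 8·z² or d = 3·y² + 2·y·z + 3·z². -/
theorem gram_aux (n : ℕ) : ∀ a b c : ℤ, 0 < a → a.toNat = n → a * c = b ^ 2 + 2 →
    ∃ p q r s : ℤ, a = p ^ 2 + 2 * q ^ 2 ∧ b = p * r + 2 * q * s ∧ c = r ^ 2 + 2 * s ^ 2 := by
  induction n using Nat.strong_induction_on with
  | _ n ih =>
    intro a b c ha hn h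
    by_cases h1 : a = 1
    · subst h1
      exact ⟨1, 0, b, 1, by norm_num, by ring, by linarith⟩
    · have ha2 : 2 ≤ a := by omega
      obtain ⟨k, hk1, hk2⟩ : ∃ k : ℤ, -a ≤ 2 * (b - k * a) ∧ 2 * (b - k * a) ≤ a := by
        refine ⟨(2 * b + a) / (2 * a), ?_, ?_⟩
        · have := Int.mul_ediv_self_le (x := 2 * b + a) (k := 2 * a) (by omega)
          nlinarith
        · have := Int.lt_mul_ediv_self_add (x := 2 * b + a) (k := 2 * a) (by omega)
          nlinarith
      have h' : (c - 2 * k * b + k ^ 2 * a) * a = (b - k * a) ^ 2 + 2 := by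
        linear_combination h
      generalize hc : c - 2 * k * b + k ^ 2 * a = c' at h'
      generalize hb : b - k * a = b' at *
      have hb4 : 4 * b' ^ 2 ≤ a ^ 2 := by nlinarith
      have hc0 : 0 < c' := by
        by_contra hcon
        nlinarith [sq_nonneg b']
      have hca : c' < a := by
        by_contra hcon
        nlinarith
      obtain ⟨p, q, r, s, e1, e2, e3⟩ := ih c'.toNat (by omega) c' b' a hc0 rfl h'
      refine ⟨r, s, p + k * r, q + k * s, e3, ?_, ?_⟩
      · linear_combination hb + e2 + k * e3
      · linear_combination hc + e1 + 2 * k * (hb + e2) + k ^ 2 * e3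

theorem stmt_12 (t u d : ℤ) (hcop : IsCoprime t u) (hd : d > 0)
    (hodd : ¬ (2 ∣ d)) (hdvd : d ∣ t ^ 2 + 8 * u ^ 2) :
    ∃ y z : ℤ, d = y ^ 2 + 8 * z ^ 2 ∨
      d = 3 * y ^ 2 + 2 * y * z + 3 * z ^ 2 := by
  have hu : IsCoprime u d := by
    have h1 : IsCoprime u (t ^ 2 + u * (8 * u)) :=
      (hcop.symm.pow_right (n := 2)).add_mul_left_right _
    refine h1.of_isCoprime_of_dvd_right ?_
    have e : t ^ 2 + u * (8 * u) = t ^ 2 + 8 * u ^ 2 := by ring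
    rw [e]
    exact hdvd
  have h2 : IsCoprime (2 : ℤ) d := (Int.prime_two.coprime_iff_not_dvd).2 hodd
  obtain ⟨x, y, hxy⟩ := h2.mul_left hu
  obtain ⟨k, hk⟩ := hdvd
  obtain ⟨p, q, -, -, hpq, -, -⟩ := gram_aux d.toNat d (t * x)
    (x ^ 2 * k + 2 * y * (1 + x * (2 * u))) hd rfl (by
      linear_combination (-x ^ 2) * hk + 2 * (1 + x * (2 * u)) * hxy)
  have hp : p % 2 = 1 := by
    rcases Int.emod_two_eq_zero_or_one p with h | h
    · obtain ⟨m, rfl⟩ := Int.dvd_of_emod_eq_zero h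
      exact absurd ⟨2 * m ^ 2 + q ^ 2, by rw [hpq]; ring⟩ hodd
    · exact h
  rcases Int.emod_two_eq_zero_or_one q with h | h
  · obtain ⟨m, rfl⟩ := Int.dvd_of_emod_eq_zero h
    exact ⟨p, m, Or.inl (by rw [hpq]; ring)⟩
  · obtain ⟨m, hm⟩ : ∃ m, p = q + 2 * m := ⟨(p - q) / 2, by omega⟩
    exact ⟨q + m, -m, Or.inr (by rw [hpq, hm]; ring)⟩
end

section
/- There do not exist integers M, N, m, n with M·n − N·m = 1 or M·n − N·m = −1 such that for all integers y and z, (M·y + N·z)² − 7·(m·y + n·z)² = 7·z² − y². (The quadratic forms y² − 7·z² and 7·z² − y² cannot be transformed into one another by any integral change of variables of determinant ±1.) -/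
theorem stmt_13 :
    ¬ ∃ M N m n : ℤ, (M * n - N * m = 1 ∨ M * n - N * m = -1) ∧
      ∀ y z : ℤ,
        (M * y + N * z) ^ 2 - 7 * (m * y + n * z) ^ 2 =
          7 * z ^ 2 - y ^ 2 := by
  rintro ⟨M, N, m, n, -, h⟩
  have h1 := h 1 0
  have h2 : M ^ 2 - 7 * m ^ 2 = -1 := by linarith
  -- modulo 4 this reads M ^ 2 + m ^ 2 = 3, which is impossible
  have h3 := congrArg (Int.cast : ℤ → ZMod 4) h2
  push_cast at h3
  have key : ∀ a b : ZMod 4, a ^ 2 - 7 * b ^ 2 ≠ -1 := by decide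
  exact key _ _ h3
end

section
/- Let t, u, d be integers with t and u relatively prime, d odd, and d dividing t² − 5·u². Then there exist integers y and z such that d = y² − 5·z², and there also exist integers y' and z' such that d = 5·z'² − y'². -/
/-- A form of discriminant 20 with an odd end coefficient is a pullback of `x² - 5y²`. -/
theorem form_pullback : ∀ (n : ℕ) (A B C : ℤ), B.natAbs ≤ n → B ^ 2 - A * C = 5 →
    (¬ (2 ∣ A) ∨ ¬ (2 ∣ C)) →
    ∃ p q r s : ℤ, A = p ^ 2 - 5 * r ^ 2 ∧ B = p * q - 5 * r * s ∧ C = q ^ 2 - 5 * s ^ 2 := by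
  intro n
  induction n using Nat.strong_induction_on with
  | _ n ih =>
  have key : ∀ (A B C : ℤ), B.natAbs ≤ n → B ^ 2 - A * C = 5 →
      (¬ (2 ∣ A) ∨ ¬ (2 ∣ C)) → |A| ≤ |C| →
      ∃ p q r s : ℤ, A = p ^ 2 - 5 * r ^ 2 ∧ B = p * q - 5 * r * s ∧
        C = q ^ 2 - 5 * s ^ 2 := by
    intro A B C hB h hodd hAC
    have hA : A ≠ 0 := by
      rintro rfl
      have h5 : B ^ 2 = 5 := by linarith
      have h1 : B < 3 := by nlinarith
      have h2 : -3 < B := by nlinarith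
      interval_cases B <;> omega
    by_cases hlt : |A| < 2 * |B|
    · -- shift
      obtain ⟨k, hk⟩ : ∃ k : ℤ, (B + k * A).natAbs < B.natAbs := by
        clear ih h hodd hAC
        rw [Int.abs_eq_natAbs, Int.abs_eq_natAbs] at hlt
        by_cases hs : (0 < A ∧ 0 < B) ∨ (A < 0 ∧ B < 0)
        · refine ⟨-1, ?_⟩
          omega
        · refine ⟨1, ?_⟩
          omega
      have hodd' : ¬ (2 ∣ A) ∨ ¬ (2 ∣ (C + 2 * k * B + k ^ 2 * A)) := by
        by_cases hA2 : 2 ∣ A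
        · right
          intro hc
          rcases hodd with ho | ho
          · exact ho hA2
          · apply ho
            have e : C = (C + 2 * k * B + k ^ 2 * A) - 2 * (k * B) - k ^ 2 * A := by ring
            rw [e]
            exact dvd_sub (dvd_sub hc (dvd_mul_right _ _)) (Dvd.dvd.mul_left hA2 _)
        · exact Or.inl hA2
      obtain ⟨p, q, r, s, h1, h2, h3⟩ := ih (B + k * A).natAbs (by omega) A (B + k * A)
        (C + 2 * k * B + k ^ 2 * A) le_rfl (by linear_combination h) hodd'
      refine ⟨p, q - k * p, r, s - k * r, h1, ?_, ?_⟩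
      · linear_combination h2 - k * h1
      · linear_combination h3 - 2 * k * h2 + k ^ 2 * h1
    · have hle : 2 * |B| ≤ |A| := by omega
      have hB0 := abs_nonneg B
      have h4 : 4 * B ^ 2 ≤ |A * C| := by
        rw [abs_mul, ← sq_abs B]
        nlinarith
      have h5 : |A * C| ≤ 5 + B ^ 2 := by
        have : A * C = B ^ 2 - 5 := by linarith
        rw [this, abs_le]
        constructor <;> nlinarith [sq_nonneg B]
      have hb1 : B < 2 := by nlinarith
      have hb2 : -2 < B := by nlinarith
      have hA2 : |A| < 3 := by
        have : |A| * |C| ≤ 5 + B ^ 2 := by rw [← abs_mul]; exact h5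
        nlinarith
      have ha := abs_lt.mp hA2
      obtain ⟨ha1, ha2⟩ := ha
      have hc : B = 0 ∨ B = 1 ∨ B = -1 := by omega
      have ha : A = 1 ∨ A = -1 ∨ A = 2 ∨ A = -2 := by omega
      rcases hc with rfl | rfl | rfl <;> rcases ha with rfl | rfl | rfl | rfl <;>
        (try (exfalso; norm_num at hle; done)) <;>
        (try (exfalso; omega))
      · exact ⟨1, 0, 0, 1, by norm_num, by norm_num, by omega⟩
      · exact ⟨2, 5, 1, 2, by norm_num, by norm_num, by omega⟩
  intro A B C hB h hodd
  rcases le_total |A| |C| with hl | hl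
  · exact key A B C hB h hodd hl
  · obtain ⟨p, q, r, s, h1, h2, h3⟩ := key C B A hB (by linarith) hodd.symm hl
    exact ⟨q, p, s, r, h3, by linarith, h1⟩

theorem stmt_16 (t u d : ℤ) (hcop : IsCoprime t u)
    (hodd : ¬ (2 ∣ d)) (hdvd : d ∣ t ^ 2 - 5 * u ^ 2) :
    (∃ y z : ℤ, d = y ^ 2 - 5 * z ^ 2) ∧
      (∃ y' z' : ℤ, d = 5 * z' ^ 2 - y' ^ 2) := by
  obtain ⟨k, hk⟩ := hdvd
  have h1 : IsCoprime (d * k) u := by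
    rw [← hk]
    have : t ^ 2 - 5 * u ^ 2 = t ^ 2 + u * (-5 * u) := by ring
    rw [this]
    exact (hcop.pow_left (m := 2)).add_mul_left_left _
  obtain ⟨b, a, hab⟩ := h1.of_mul_left_left
  obtain ⟨p, q, r, s, hp, -, -⟩ := form_pullback (t * a).natAbs d (t * a)
    (k * a ^ 2 + 5 * (-2 * b + b ^ 2 * d)) le_rfl
    (by linear_combination a ^ 2 * hk + 5 * (a * u + 1 - b * d) * hab) (Or.inl hodd)
  exact ⟨⟨p, r, hp⟩, ⟨2 * p + 5 * r, p + 2 * r, by linear_combination hp⟩⟩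
end

section
/- Let t, u, d be integers with t and u relatively prime, d odd, and d dividing t² − 7·u². Then there exist integers y and z such that either d = y² − 7·z² or d = 7·z² − y². -/
theorem exists_balanced (a b : ℤ) (ha : a ≠ 0) : ∃ k : ℤ, 4 * (b + k * a) ^ 2 ≤ a ^ 2 := by
  have h1 := Int.emod_nonneg b ha
  have h2 := Int.emod_lt_abs b ha
  have h3 := Int.emod_add_mul_ediv b a
  by_cases h : 2 * (b % a) ≤ |a|
  · refine ⟨-(b / a), ?_⟩
    have e : b + -(b / a) * a = b % a := by linarith
    rw [e, ← sq_abs a]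
    nlinarith
  · rcases abs_cases a with ⟨e, _⟩ | ⟨e, _⟩
    · refine ⟨-(b / a) - 1, ?_⟩
      have e : b + (-(b / a) - 1) * a = b % a - |a| := by rw [e]; linarith
      rw [e, ← sq_abs a]
      nlinarith
    · refine ⟨-(b / a) + 1, ?_⟩
      have e : b + (-(b / a) + 1) * a = b % a - |a| := by rw [e]; linarith
      rw [e, ← sq_abs a]
      nlinarith

theorem descent (n : ℕ) : ∀ a b : ℤ, a.natAbs = n → a ∣ b ^ 2 - 7 →
    ∃ e p q r s : ℤ, e ^ 2 = 1 ∧ a = e * (p ^ 2 - 7 * q ^ 2) ∧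
      b = p * r + 7 * q * s ∧ 1 = p * s + q * r := by
  induction n using Nat.strong_induction_on with
  | _ n ih =>
  intro a b han hab
  have hne : ∀ x : ℤ, x ^ 2 - 7 ≠ 0 := by
    intro x hx
    have h1 : x < 3 := by nlinarith
    have h2 : -3 < x := by nlinarith
    interval_cases x <;> omega
  have ha0 : a ≠ 0 := by
    rintro rfl
    exact hne b (zero_dvd_iff.mp hab)
  by_cases hsmall : n ≤ 2
  · have hc : a = 1 ∨ a = -1 ∨ a = 2 ∨ a = -2 := by omega
    have hb2 : (2 : ℤ) ∣ b ^ 2 - 7 → ∃ m, b = 2 * m + 1 := by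
      intro h
      rcases Int.even_or_odd b with hb | hb
      · obtain ⟨m, rfl⟩ := hb
        ring_nf at h
        omega
      · exact hb
    rcases hc with rfl | rfl | rfl | rfl
    · exact ⟨1, 1, 0, b, 1, by norm_num, by norm_num, by ring, by ring⟩
    · exact ⟨-1, 1, 0, b, 1, by norm_num, by norm_num, by ring, by ring⟩
    · obtain ⟨m, rfl⟩ := hb2 hab
      exact ⟨1, 3, 1, 3 * m - 2, 1 - m, by norm_num, by norm_num, by ring, by ring⟩
    · obtain ⟨m, rfl⟩ := hb2 (by simpa using hab)
      exact ⟨-1, 3, 1, 3 * m - 2, 1 - m, by norm_num, by norm_num, by ring, by ring⟩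
  · obtain ⟨k, hk⟩ := exists_balanced a b ha0
    obtain ⟨c, hc⟩ : a ∣ (b + k * a) ^ 2 - 7 := by
      obtain ⟨w, hw⟩ := hab
      exact ⟨w + 2 * b * k + k ^ 2 * a, by linear_combination hw⟩
    have ha3 : 3 ≤ |a| := by rw [Int.abs_eq_natAbs]; omega
    have hB : 0 ≤ (b + k * a) ^ 2 := sq_nonneg _
    have ha9 : 9 ≤ |a| ^ 2 := by nlinarith
    have hlt : |c| < |a| := by
      have h1 : |a| * |c| < |a| * |a| := by
        rw [← abs_mul, ← hc, abs_lt]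
        rw [← sq_abs a] at hk
        constructor <;> nlinarith
      exact lt_of_mul_lt_mul_left h1 (abs_nonneg a)
    obtain ⟨e, p, q, r, s, he, hcc, hb, h1⟩ :=
      ih c.natAbs (by rw [Int.abs_eq_natAbs, Int.abs_eq_natAbs] at hlt; omega) c (b + k * a) rfl ⟨a, by rw [hc]; ring⟩
    have hc0 : c ≠ 0 := by
      rintro rfl
      exact hne (b + k * a) (by rw [hc]; ring)
    have hae : a = e * (r ^ 2 - 7 * s ^ 2) := by
      apply mul_right_cancel₀ hc0
      rw [← hc, hb, hcc]
      linear_combination (-(p ^ 2 - 7 * q ^ 2) * (r ^ 2 - 7 * s ^ 2)) * he +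
        7 * (1 + (p * s + q * r)) * (-h1)
    refine ⟨e, r, s, p - k * e * r, q + k * e * s, he, hae, ?_, ?_⟩
    · linear_combination hb - k * hae
    · linear_combination h1

theorem stmt_17 (t u d : ℤ) (hcop : IsCoprime t u)
    (hodd : ¬ (2 ∣ d)) (hdvd : d ∣ t ^ 2 - 7 * u ^ 2) :
    ∃ y z : ℤ, d = y ^ 2 - 7 * z ^ 2 ∨ d = 7 * z ^ 2 - y ^ 2 := by
  have h1 : IsCoprime (t ^ 2 - 7 * u ^ 2) u := by
    have h0 : IsCoprime (t ^ 2) u := hcop.pow_left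
    have h := h0.add_mul_right_left (-7 * u)
    have e : t ^ 2 - 7 * u ^ 2 = t ^ 2 + -7 * u * u := by ring
    rw [e]
    exact h
  obtain ⟨f, g, hfg⟩ := h1.of_isCoprime_of_dvd_left hdvd
  obtain ⟨w, hw⟩ := hdvd
  have h2 : d ∣ (t * g) ^ 2 - 7 :=
    ⟨w * g ^ 2 - 7 * f * (1 + g * u), by
      linear_combination g ^ 2 * hw + 7 * (1 + g * u) * hfg⟩
  obtain ⟨e, p, q, r, s, he, hd, -, -⟩ := descent _ d (t * g) rfl h2
  refine ⟨p, q, ?_⟩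
  rcases (show e = 1 ∨ e = -1 from by simpa using he) with rfl | rfl
  · left; linarith
  · right; linarith
end

section
/- Let a, p, q, r, P, Q, R be integers with a > 0, p·r − q² = a, P·R − Q² = a, 2·|q| ≤ |p|, 2·|q| ≤ |r|, 2·|Q| ≤ |P|, and 2·|Q| ≤ |R|. Suppose there exist integers M, N, m, n with M·n − N·m = 1 or M·n − N·m = −1 such that P = p·M² + 2·q·M·m + r·m², Q = p·M·N + q·(M·n + N·m) + r·m·n, and R = p·N² + 2·q·N·n + r·n². Then (P = p and R = r) or (P = r and R = p), and Q = q or Q = −q. (A definite binary quadratic form satisfying the reduction conditions cannot be transformed by a unimodular integral substitution into any essentially different form satisfying the same conditions.) -/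
theorem aux_r (p q r x y : ℤ) (hp : 0 < p) (hr : p ≤ r) (hq : 2 * |q| ≤ p) (hy : y ≠ 0) :
    r ≤ p * x ^ 2 + 2 * q * x * y + r * y ^ 2 := by
  have hY : 1 ≤ |y| := Int.one_le_abs hy
  have hX : 0 ≤ |x| := abs_nonneg x
  have h1 : -(|q| * (|x| * |y|)) ≤ q * (x * y) := by
    have := neg_abs_le (q * (x * y))
    rwa [abs_mul, abs_mul] at this
  have h2 : 2 * |q| * (|x| * |y|) ≤ p * (|x| * |y|) :=
    mul_le_mul_of_nonneg_right hq (by positivity)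
  rw [← sq_abs x, ← sq_abs y]
  generalize |x| = X at *
  generalize |y| = Y at *
  suffices h : r ≤ p * X ^ 2 - p * (X * Y) + r * Y ^ 2 by nlinarith
  rcases le_or_gt Y X with h | h
  · have a1 : 0 ≤ p * (X * (X - Y)) :=
      mul_nonneg hp.le (mul_nonneg hX (by linarith))
    have a2 : 0 ≤ r * (Y ^ 2 - 1) := mul_nonneg (by linarith) (by nlinarith)
    nlinarith
  · have a1 : 0 ≤ (r - p) * (X * (Y - X)) :=
      mul_nonneg (by linarith) (mul_nonneg hX (by linarith))
    have a2 : 0 ≤ r * (Y ^ 2 - X * Y + X ^ 2 - 1) :=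
      mul_nonneg (by linarith) (by nlinarith)
    nlinarith

theorem aux_key (p q r P R M N m n : ℤ) (hp : 0 < p) (hr : p ≤ r) (hq : 2 * |q| ≤ p)
    (hd : M * n - N * m ≠ 0) (hPR : P ≤ R)
    (hP : P = p * M ^ 2 + 2 * q * M * m + r * m ^ 2)
    (hR : R = p * N ^ 2 + 2 * q * N * n + r * n ^ 2) : p ≤ P ∧ r ≤ R := by
  constructor
  · by_cases hm : m = 0
    · subst hm
      have hM : M ≠ 0 := by rintro rfl; simp at hd
      have : 0 < M ^ 2 := by positivity
      nlinarith
    · have := aux_r p q r M m hp hr hq hm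
      linarith
  · by_cases hn : n = 0
    · have hm : m ≠ 0 := by rintro rfl; simp [hn] at hd
      have := aux_r p q r M m hp hr hq hm
      linarith
    · have := aux_r p q r N n hp hr hq hn
      linarith

theorem aux_ord (p q r P Q R M N m n : ℤ) (hp : 0 < p) (hr : p ≤ r) (hq : 2 * |q| ≤ p)
    (hQ : 2 * |Q| ≤ |P|)
    (hd : M * n - N * m = 1 ∨ M * n - N * m = -1) (hPR : P ≤ R)
    (hP : P = p * M ^ 2 + 2 * q * M * m + r * m ^ 2)
    (hQe : Q = p * M * N + q * (M * n + N * m) + r * m * n)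
    (hR : R = p * N ^ 2 + 2 * q * N * n + r * n ^ 2) : P = p ∧ R = r := by
  have hd0 : M * n - N * m ≠ 0 := by rcases hd with h | h <;> rw [h] <;> norm_num
  have hd2 : (M * n - N * m) ^ 2 = 1 := by rcases hd with h | h <;> rw [h] <;> norm_num
  obtain ⟨k1, k2⟩ := aux_key p q r P R M N m n hp hr hq hd0 hPR hP hR
  rw [abs_of_pos (by linarith : 0 < P)] at hQ
  obtain ⟨k3, k4⟩ := aux_key P Q R p r n (-N) (-m) M (by linarith) hPR hQ
    (by intro h; apply hd0; linarith) hr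
    (by rw [hP, hQe, hR]; linear_combination (-p) * hd2)
    (by rw [hP, hQe, hR]; linear_combination (-r) * hd2)
  constructor <;> linarith

theorem aux_pos (p q r P Q R M N m n : ℤ) (hp : 0 < p) (hr : 0 < r)
    (hq1 : 2 * |q| ≤ p) (hq2 : 2 * |q| ≤ r)
    (hQ1 : 2 * |Q| ≤ |P|) (hQ2 : 2 * |Q| ≤ |R|)
    (hd : M * n - N * m = 1 ∨ M * n - N * m = -1)
    (hP : P = p * M ^ 2 + 2 * q * M * m + r * m ^ 2)
    (hQe : Q = p * M * N + q * (M * n + N * m) + r * m * n)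
    (hR : R = p * N ^ 2 + 2 * q * N * n + r * n ^ 2) :
    (P = p ∧ R = r) ∨ (P = r ∧ R = p) := by
  rcases le_total p r with h | h <;> rcases le_total P R with h' | h'
  · exact Or.inl (aux_ord p q r P Q R M N m n hp h hq1 hQ1 hd h' hP hQe hR)
  · have := aux_ord p q r R Q P N M n m hp h hq1 hQ2
      (by rcases hd with h | h; right; linarith; left; linarith) h' hR (by rw [hQe]; ring) hP
    exact Or.inr this.symm
  · have := aux_ord r q p P Q R m n M N hr h hq2 hQ1
      (by rcases hd with h | h; right; linarith; left; linarith) h'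
      (by rw [hP]; ring) (by rw [hQe]; ring) (by rw [hR]; ring)
    exact Or.inr this
  · have := aux_ord r q p R Q P n m N M hr h hq2 hQ2
      (by rcases hd with h | h; left; linarith; right; linarith) h'
      (by rw [hR]; ring) (by rw [hQe]; ring) (by rw [hP]; ring)
    exact Or.inl this.symm

theorem stmt_18 (a p q r P Q R : ℤ) (ha : a > 0)
    (hpr : p * r - q ^ 2 = a) (hPR : P * R - Q ^ 2 = a)
    (hq1 : 2 * |q| ≤ |p|) (hq2 : 2 * |q| ≤ |r|)
    (hQ1 : 2 * |Q| ≤ |P|) (hQ2 : 2 * |Q| ≤ |R|)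
    (h : ∃ M N m n : ℤ, (M * n - N * m = 1 ∨ M * n - N * m = -1) ∧
      P = p * M ^ 2 + 2 * q * M * m + r * m ^ 2 ∧
      Q = p * M * N + q * (M * n + N * m) + r * m * n ∧
      R = p * N ^ 2 + 2 * q * N * n + r * n ^ 2) :
    ((P = p ∧ R = r) ∨ (P = r ∧ R = p)) ∧ (Q = q ∨ Q = -q) := by
  obtain ⟨M, N, m, n, hd, hP, hQ, hR⟩ := h
  have main : (P = p ∧ R = r) ∨ (P = r ∧ R = p) := by
    have hpos : 0 < p * r := by nlinarith [sq_nonneg q]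
    rcases mul_pos_iff.mp hpos with ⟨h1, h2⟩ | ⟨h1, h2⟩
    · rw [abs_of_pos h1] at hq1
      rw [abs_of_pos h2] at hq2
      exact aux_pos p q r P Q R M N m n h1 h2 hq1 hq2 hQ1 hQ2 hd hP hQ hR
    · rw [abs_of_neg h1] at hq1
      rw [abs_of_neg h2] at hq2
      have := aux_pos (-p) (-q) (-r) (-P) (-Q) (-R) M N m n (by linarith) (by linarith)
        (by rwa [abs_neg]) (by rwa [abs_neg]) (by rwa [abs_neg, abs_neg])
        (by rwa [abs_neg, abs_neg]) hd (by rw [hP]; ring) (by rw [hQ]; ring) (by rw [hR]; ring)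
      simpa only [neg_inj] using this
  refine ⟨main, sq_eq_sq_iff_eq_or_eq_neg.mp ?_⟩
  rcases main with ⟨h1, h2⟩ | ⟨h1, h2⟩ <;> rw [h1, h2] at hPR <;> linarith
end

section
/- Let t, u, d be integers with t and u relatively prime, d odd, and d dividing t² − 79·u². Then there exist integers y and z such that d = y² − 79·z², or d = 79·z² − y², or d = 3·y² + 2·y·z − 26·z², or d = 26·z² + 2·y·z − 3·y². -/
/-- The integers represented by one of the four forms. -/
def IsRep79 (d : ℤ) : Prop :=
  ∃ y z : ℤ, d = y ^ 2 - 79 * z ^ 2 ∨ d = 79 * z ^ 2 - y ^ 2 ∨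
      d = 3 * y ^ 2 + 2 * y * z - 26 * z ^ 2 ∨
      d = 26 * z ^ 2 + 2 * y * z - 3 * y ^ 2

theorem IsRep79.neg {d : ℤ} (h : IsRep79 d) : IsRep79 (-d) := by
  obtain ⟨y, z, h | h | h | h⟩ := h
  · exact ⟨y, z, Or.inr (Or.inl (by rw [h]; ring))⟩
  · exact ⟨y, z, Or.inl (by rw [h]; ring)⟩
  · exact ⟨y, -z, Or.inr (Or.inr (Or.inr (by rw [h]; ring)))⟩
  · exact ⟨y, -z, Or.inr (Or.inr (Or.inl (by rw [h]; ring)))⟩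

/-- Reduced forms with positive leading coefficient and nonnegative middle coefficient. -/
theorem rep_reduced_pos (a b c : ℤ) (h : b ^ 2 - a * c = 79) (ha : 0 < a) (hb : 0 ≤ b)
    (h1 : 2 * b ≤ a) (h2 : a ≤ |c|) (x y : ℤ) : IsRep79 (a * x ^ 2 + 2 * b * x * y + c * y ^ 2) := by
  have hc : c < 0 := by
    by_contra hc
    rw [abs_of_nonneg (by omega)] at h2
    nlinarith
  rw [abs_of_neg hc] at h2
  have ha8 : a ≤ 8 := by nlinarith
  have hb4 : b ≤ 4 := by omega
  have key : (a = 1 ∧ b = 0 ∧ c = -79) ∨ (a = 2 ∧ b = 1 ∧ c = -39) ∨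
      (a = 3 ∧ b = 1 ∧ c = -26) ∨ (a = 6 ∧ b = 1 ∧ c = -13) ∨
      (a = 5 ∧ b = 2 ∧ c = -15) ∨ (a = 7 ∧ b = 3 ∧ c = -10) := by
    interval_cases a <;> interval_cases b <;> omega
  rcases key with ⟨rfl, rfl, rfl⟩ | ⟨rfl, rfl, rfl⟩ | ⟨rfl, rfl, rfl⟩ | ⟨rfl, rfl, rfl⟩ |
    ⟨rfl, rfl, rfl⟩ | ⟨rfl, rfl, rfl⟩
  · exact ⟨x, y, Or.inl (by ring)⟩
  · exact ⟨-9 * x + 35 * y, -x + 4 * y, Or.inl (by ring)⟩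
  · exact ⟨x, y, Or.inr (Or.inr (Or.inl (by ring)))⟩
  · exact ⟨-8 * x - 13 * y, -3 * x - 5 * y, Or.inr (Or.inr (Or.inl (by ring)))⟩
  · exact ⟨-3 * x - 7 * y, -x - 2 * y, Or.inr (Or.inr (Or.inr (by ring)))⟩
  · exact ⟨-3 * x + 2 * y, -x + y, Or.inr (Or.inr (Or.inl (by ring)))⟩

theorem rep_reduced_a_pos (a b c : ℤ) (h : b ^ 2 - a * c = 79) (ha : 0 < a)
    (h1 : 2 * |b| ≤ a) (h2 : a ≤ |c|) (x y : ℤ) :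
    IsRep79 (a * x ^ 2 + 2 * b * x * y + c * y ^ 2) := by
  rcases le_total 0 b with hb | hb
  · rw [abs_of_nonneg hb] at h1
    exact rep_reduced_pos a b c h ha hb h1 h2 x y
  · rw [abs_of_nonpos hb] at h1
    have := rep_reduced_pos a (-b) c (by linarith [neg_sq b]) ha (by omega) h1 h2 x (-y)
    convert this using 1
    ring

theorem not_sq (b : ℤ) : b ^ 2 ≠ 79 := by
  intro h
  have h1 : b ≤ 8 := by nlinarith
  have h2 : -8 ≤ b := by nlinarith
  interval_cases b <;> omega

theorem rep_form (n : ℕ) : ∀ a b c : ℤ, a.natAbs = n → b ^ 2 - a * c = 79 → ∀ x y : ℤ,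
    IsRep79 (a * x ^ 2 + 2 * b * x * y + c * y ^ 2) := by
  induction n using Nat.strong_induction_on with
  | _ n ih =>
    intro a b c hn h x y
    have ha : a ≠ 0 := by
      rintro rfl
      exact not_sq b (by linarith)
    obtain ⟨k, hk⟩ : ∃ k : ℤ, 2 * |b - k * a| ≤ |a| := by
      have hpos := abs_pos.mpr ha
      have e1 := Int.emod_add_mul_ediv b a
      have e2 := Int.emod_nonneg b ha
      have e3 := Int.emod_lt_abs b ha
      by_cases hs : 2 * (b % a) ≤ |a|
      · refine ⟨b / a, ?_⟩
        have : b - b / a * a = b % a := by linarith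
        rw [this, abs_of_nonneg e2]
        exact hs
      · refine ⟨b / a + a.sign, ?_⟩
        have : b - (b / a + a.sign) * a = b % a - |a| := by
          have := Int.sign_mul_self_eq_abs a
          linarith
        rw [this, abs_of_neg (by linarith)]
        linarith
    obtain ⟨b', hb'⟩ : ∃ b', b' = b - k * a := ⟨_, rfl⟩
    obtain ⟨c', hc'⟩ : ∃ c', c' = c - 2 * k * b + k ^ 2 * a := ⟨_, rfl⟩
    rw [← hb'] at hk
    have h' : b' ^ 2 - a * c' = 79 := by rw [hb', hc', ← h]; ring
    have e : a * x ^ 2 + 2 * b * x * y + c * y ^ 2 =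
        a * (x + k * y) ^ 2 + 2 * b' * (x + k * y) * y + c' * y ^ 2 := by
      rw [hb', hc']; ring
    rw [e]
    generalize x + k * y = w
    by_cases hlt : c'.natAbs < n
    · have := ih _ hlt c' b' a rfl (by linarith) y w
      convert this using 1
      ring
    · have hle : |a| ≤ |c'| := by rw [Int.abs_eq_natAbs, Int.abs_eq_natAbs]; omega
      rcases lt_or_gt_of_ne ha with hneg | hpos
      · rw [abs_of_neg hneg] at hk hle
        have := (rep_reduced_a_pos (-a) (-b') (-c') (by linarith) (by omega)
          (by rw [abs_neg]; exact hk) (by rw [abs_neg]; exact hle) w y).neg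
        convert this using 1
        ring
      · rw [abs_of_pos hpos] at hk hle
        exact rep_reduced_a_pos a b' c' h' hpos hk hle w y

theorem stmt_19 (t u d : ℤ) (hcop : IsCoprime t u)
    (hodd : ¬ (2 ∣ d)) (hdvd : d ∣ t ^ 2 - 79 * u ^ 2) :
    ∃ y z : ℤ, d = y ^ 2 - 79 * z ^ 2 ∨ d = 79 * z ^ 2 - y ^ 2 ∨
      d = 3 * y ^ 2 + 2 * y * z - 26 * z ^ 2 ∨
      d = 26 * z ^ 2 + 2 * y * z - 3 * y ^ 2 := by
  obtain ⟨k, hk⟩ := hdvd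
  have hud : IsCoprime d u := by
    have h1 : IsCoprime (t ^ 2) u := hcop.pow_left
    have h2 : t ^ 2 = d * k + u * (79 * u) := by linarith
    rw [h2] at h1
    exact (IsCoprime.of_add_mul_left_left h1).of_mul_left_left
  obtain ⟨q, p, hpq⟩ := hud
  have hform : (t * p) ^ 2 - d * (p ^ 2 * k + 79 * (-2 * q + q ^ 2 * d)) = 79 := by
    have hpu : p * u = 1 - q * d := by linarith
    linear_combination p ^ 2 * hk + 79 * (p * u + (1 - q * d)) * hpu
  have := rep_form _ d (t * p) _ rfl hform 1 0
  simpa [IsRep79] using this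
end
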